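/- arXiv:1312.1771 — 3 statements merged into one kernel-verified Lean document; each statement's English description precedes it below -/
import Mathlib

section
/- Let 𝒜 = {L_1, …, L_n} be n ≥ 1 pairwise distinct affine lines in ℂ², let p be a prime with p dividing n+1, and work over the field 𝔽_p = ℤ/pℤ. Assume: (a) 𝒜 has at least two parallel classes (equivalently, the projectivized arrangement together with the line at infinity is essential); and (b) at most one parallel class C satisfies p | (#C + 1) (equivalently, the line at infinity contains at most one point whose multiplicity in the projective arrangement is divisible by p). Let ν = e_1 + ⋯ + e_n ∈ Λ(𝔽_p^n). Then for every c : {1, …, n} → 𝔽_p, if ν ∧ (c_1 e_1 + ⋯ + c_n e_n) ∈ I_{𝔽_p}(𝒜), then there is t ∈ 𝔽_p with c_i = t for all i. (Equivalently, the first cohomology of the Aomoto complex (A_{𝔽_p}(𝒜), ν∧ · ) vanishes: H¹(A_{𝔽_p}(𝒜), ν) = 0.) -/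
noncomputable section
open scoped Classical

/-- `L` is an (affine) line in `ℂ²`: a nonempty affine subspace whose direction
has dimension one. -/
def IsLine (L : AffineSubspace ℂ (ℂ × ℂ)) : Prop :=
  (L : Set (ℂ × ℂ)).Nonempty ∧ Module.finrank ℂ L.direction = 1

/-- Indices `i`, `j` are parallel: `i = j` or the lines do not meet. -/
def Par {n : ℕ} (L : Fin n → AffineSubspace ℂ (ℂ × ℂ)) (i j : Fin n) : Prop :=
  i = j ∨ (L i : Set (ℂ × ℂ)) ∩ (L j : Set (ℂ × ℂ)) = ∅

/-- The image `e_i` of the `i`-th standard basis vector of `R^n` in `Λ(R^n)`. -/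
def gen (R : Type*) [CommRing R] (n : ℕ) (i : Fin n) :
    ExteriorAlgebra R (Fin n → R) :=
  ExteriorAlgebra.ι R (Pi.single i 1)

/-- Generators of the Orlik-Solomon ideal of the line arrangement `L`. -/
def osGens (R : Type*) [CommRing R] {n : ℕ}
    (L : Fin n → AffineSubspace ℂ (ℂ × ℂ)) :
    Set (ExteriorAlgebra R (Fin n → R)) :=
  {x | ∃ i j : Fin n, i ≠ j ∧ (L i : Set (ℂ × ℂ)) ∩ (L j : Set (ℂ × ℂ)) = ∅ ∧
        x = gen R n i * gen R n j} ∪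
  {x | ∃ i j k : Fin n, i ≠ j ∧ i ≠ k ∧ j ≠ k ∧
        ((L i : Set (ℂ × ℂ)) ∩ (L j : Set (ℂ × ℂ)) ∩ (L k : Set (ℂ × ℂ))).Nonempty ∧
        x = gen R n i * gen R n j - gen R n i * gen R n k + gen R n j * gen R n k}

/-- The Orlik-Solomon ideal `I_R(𝒜)`: the two-sided ideal generated by `osGens`. -/
def osIdeal (R : Type*) [CommRing R] {n : ℕ}
    (L : Fin n → AffineSubspace ℂ (ℂ × ℂ)) :
    TwoSidedIdeal (ExteriorAlgebra R (Fin n → R)) :=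
  TwoSidedIdeal.span (osGens R L)

/-- The parallel class of the index `i`, as a finset of indices. -/
def parClass {n : ℕ} (L : Fin n → AffineSubspace ℂ (ℂ × ℂ)) (i : Fin n) :
    Finset (Fin n) :=
  Finset.univ.filter (fun j => Par L i j)

/-- A pair of linear functionals `f`, `g` gives a representation of the exterior algebra on which
the product of two vectors acts through the `2`-form `f ∧ g`. -/
theorem exists_algHom_matrix_of_wedge {R M : Type*} [CommRing R] [AddCommGroup M] [Module R M]
    (f g : M →ₗ[R] R) :
    ∃ F : ExteriorAlgebra R M →ₐ[R] Matrix (Fin 4) (Fin 4) R, ∀ v w,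
      F (ExteriorAlgebra.ι R v * ExteriorAlgebra.ι R w) =
        (f v * g w - g v * f w) • Matrix.single 0 3 1 := by
  let A : Matrix (Fin 4) (Fin 4) R := !![0, 1, 0, 0; 0, 0, 0, 0; 0, 0, 0, 1; 0, 0, 0, 0]
  let B : Matrix (Fin 4) (Fin 4) R := !![0, 0, -1, 0; 0, 0, 0, 1; 0, 0, 0, 0; 0, 0, 0, 0]
  let T : M →ₗ[R] Matrix (Fin 4) (Fin 4) R := f.smulRight A + g.smulRight B
  have hT : ∀ v w, T v * T w = (f v * g w - g v * f w) • Matrix.single 0 3 1 := by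
    intro v w
    ext a b
    fin_cases a <;> fin_cases b <;>
      (simp [T, A, B, Matrix.mul_apply, Fin.sum_univ_four]; try ring)
  have hT0 : ∀ v, T v * T v = 0 := fun v => by
    rw [hT, mul_comm, sub_self, zero_smul]
  refine ⟨ExteriorAlgebra.lift R ⟨T, hT0⟩, fun v w => ?_⟩
  rw [map_mul, ExteriorAlgebra.lift_ι_apply, ExteriorAlgebra.lift_ι_apply]
  exact hT v w

/-- Lines with a common direction and a common point coincide. -/
theorem eq_of_direction_eq_of_mem {L L' : AffineSubspace ℂ (ℂ × ℂ)}
    (h : L.direction = L'.direction) {z : ℂ × ℂ} (hz : z ∈ L) (hz' : z ∈ L') : L = L' :=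
  AffineSubspace.ext_of_direction_eq h ⟨z, hz, hz'⟩

/-- Two lines through two distinct points coincide. -/
theorem IsLine.eq_of_mem_of_mem {L L' : AffineSubspace ℂ (ℂ × ℂ)} (hL : IsLine L)
    (hL' : IsLine L') {z w : ℂ × ℂ} (hzw : z ≠ w) (hz : z ∈ L) (hw : w ∈ L)
    (hz' : z ∈ L') (hw' : w ∈ L') : L = L' := by
  have key : ∀ K : AffineSubspace ℂ (ℂ × ℂ), IsLine K → z ∈ K → w ∈ K →
      Submodule.span ℂ {z -ᵥ w} = K.direction := by
    intro K hK hz hw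
    refine Submodule.eq_of_le_of_finrank_eq ?_ ?_
    · rw [Submodule.span_singleton_le_iff_mem]
      exact AffineSubspace.vsub_mem_direction hz hw
    · rw [finrank_span_singleton (vsub_ne_zero.2 hzw), hK.2]
  exact eq_of_direction_eq_of_mem ((key L hL hz hw).symm.trans (key L' hL' hz' hw')) hz hz'

/-- Lines with distinct directions in the plane meet. -/
theorem IsLine.inter_nonempty_of_direction_ne {L L' : AffineSubspace ℂ (ℂ × ℂ)} (hL : IsLine L)
    (hL' : IsLine L') (h : L.direction ≠ L'.direction) :
    ((L : Set (ℂ × ℂ)) ∩ (L' : Set (ℂ × ℂ))).Nonempty := by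
  refine AffineSubspace.inter_nonempty_of_nonempty_of_sup_direction_eq_top hL.1 hL'.1 ?_
  have hlt : L.direction < L.direction ⊔ L'.direction := by
    refine lt_of_le_of_ne le_sup_left fun he => h ?_
    have hle : L'.direction ≤ L.direction := he ▸ le_sup_right
    exact (Submodule.eq_of_le_of_finrank_eq hle (hL'.2.trans hL.2.symm)).symm
  have h1 := Submodule.finrank_lt_finrank_of_lt hlt
  have h2 := Submodule.finrank_le (L.direction ⊔ L'.direction)
  have h3 : Module.finrank ℂ (ℂ × ℂ) = 2 := by simp
  apply Submodule.eq_top_of_finrank_eq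
  rw [hL.2] at h1
  omega

/-- Parallelism of distinct lines is equality of directions. -/
theorem par_iff_direction_eq {n : ℕ} {L : Fin n → AffineSubspace ℂ (ℂ × ℂ)}
    (hline : ∀ i, IsLine (L i)) (hdist : Function.Injective L) (i j : Fin n) :
    Par L i j ↔ (L i).direction = (L j).direction := by
  constructor
  · rintro (rfl | h)
    · rfl
    · by_contra hne
      exact ((hline i).inter_nonempty_of_direction_ne (hline j) hne).ne_empty h
  · intro h
    by_cases hij : i = j
    · exact Or.inl hij
    · refine Or.inr (Set.eq_empty_iff_forall_notMem.2 fun z hz => hij (hdist ?_))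
      exact eq_of_direction_eq_of_mem h hz.1 hz.2

/-- Cocycle condition at a point `z` of the line `L i`. -/
theorem sum_sub_eq_zero_of_mem_osIdeal {R : Type*} [CommRing R] {n : ℕ}
    {L : Fin n → AffineSubspace ℂ (ℂ × ℂ)} (hline : ∀ i, IsLine (L i))
    (hdist : Function.Injective L) {c : Fin n → R}
    (hker : (∑ i, gen R n i) * (∑ i, c i • gen R n i) ∈ osIdeal R L)
    {z : ℂ × ℂ} {i : Fin n} (hz : z ∈ L i) :
    ∑ k with z ∈ L k, (c i - c k) = 0 := by
  let x : Fin n → R := fun j => if z ∈ L j then 1 else 0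
  let f : (Fin n → R) →ₗ[R] R := ∑ j, x j • LinearMap.proj j
  let g : (Fin n → R) →ₗ[R] R := LinearMap.proj i
  have hf : ∀ v, f v = ∑ j, x j * v j := fun v => by simp [f]
  have hf1 : ∀ j, f (Pi.single j 1) = x j := fun j => by simp [hf, Pi.single_apply]
  have hg1 : ∀ j, g (Pi.single j 1) = if i = j then 1 else 0 := fun j => by
    simp [g, Pi.single_apply]
  obtain ⟨F, hF⟩ := exists_algHom_matrix_of_wedge f g
  have hle : osIdeal R L ≤ TwoSidedIdeal.ker F := by
    refine TwoSidedIdeal.span_le.2 ?_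
    rintro _ (⟨a, b, hab, he, rfl⟩ | ⟨a, b, d, hab, had, hbd, ⟨w, ⟨hwa, hwb⟩, hwd⟩, rfl⟩)
    · have hnot : ¬ (z ∈ L a ∧ z ∈ L b) := fun h =>
        (Set.eq_empty_iff_forall_notMem.1 he) z h
      rw [SetLike.mem_coe, TwoSidedIdeal.mem_ker]
      simp only [gen, hF, hf1, hg1, x]
      convert zero_smul R _
      grind
    · have hpair : ∀ {a b}, a ≠ b → w ∈ L a → w ∈ L b → z ∈ L a → z ∈ L b → z = w := by
        intro a b hab h1 h2 h3 h4
        by_contra hzw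
        exact hab (hdist ((hline a).eq_of_mem_of_mem (hline b) hzw h3 h1 h4 h2))
      rw [SetLike.mem_coe, TwoSidedIdeal.mem_ker]
      simp only [gen, map_add, map_sub, hF, hf1, hg1, x, ← add_smul, ← sub_smul]
      convert zero_smul R _
      have hab' := hpair hab hwa hwb
      have had' := hpair had hwa hwd
      have hbd' := hpair hbd hwb hwd
      have hwa' : w ∈ L a := hwa
      have hwb' : w ∈ L b := hwb
      have hwd' : w ∈ L d := hwd
      grind
  have h0 := (TwoSidedIdeal.mem_ker F).1 (hle hker)
  have hν : ∑ j, gen R n j = ExteriorAlgebra.ι R 1 := by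
    simp only [gen, ← map_sum]
    congr 1
    exact Finset.univ_sum_single (1 : Fin n → R)
  have hη : ∑ j, c j • gen R n j = ExteriorAlgebra.ι R c := by
    simp only [gen, ← map_smul, ← map_sum]
    congr 1
    ext j
    simp [Pi.single_apply]
  rw [hν, hη, hF] at h0
  have h1 := congrFun (congrFun h0 0) 3
  simp only [Matrix.smul_apply, Matrix.single_apply_same, smul_eq_mul, hf, g, x, LinearMap.proj_apply, Pi.one_apply,
    Matrix.zero_apply, mul_one, one_mul, ite_mul, zero_mul, Finset.sum_ite, Finset.sum_const_zero,
    add_zero] at h1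
  rw [Finset.sum_sub_distrib, ← h1, Finset.sum_mul]
  simp

/-- Sum of the cocycle conditions over all points of the line `L i`. -/
theorem sum_not_par_sub_eq_zero {R : Type*} [CommRing R] {n : ℕ}
    {L : Fin n → AffineSubspace ℂ (ℂ × ℂ)} (hline : ∀ i, IsLine (L i))
    (hdist : Function.Injective L) {c : Fin n → R}
    (hker : (∑ i, gen R n i) * (∑ i, c i • gen R n i) ∈ osIdeal R L) (i : Fin n) :
    ∑ j with ¬ Par L i j, (c i - c j) = 0 := by
  have hmeet : ∀ j, ∃ z, ¬ Par L i j → z ∈ L i ∧ z ∈ L j := fun j => by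
    by_cases h : Par L i j
    · exact ⟨0, fun h' => absurd h h'⟩
    · obtain ⟨z, hz⟩ := Set.nonempty_iff_ne_empty.2 (not_or.1 h).2
      exact ⟨z, fun _ => hz⟩
  choose q hq using hmeet
  rw [← Finset.sum_fiberwise_of_maps_to
    (t := ({j | ¬ Par L i j} : Finset (Fin n)).image q) (g := q)
    fun j hj => Finset.mem_image_of_mem q hj]
  refine Finset.sum_eq_zero fun z hz => ?_
  obtain ⟨j₀, hj₀, rfl⟩ := Finset.mem_image.1 hz
  have hzi : q j₀ ∈ L i := (hq j₀ (Finset.mem_filter.1 hj₀).2).1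
  rw [← sum_sub_eq_zero_of_mem_osIdeal hline hdist hker hzi]
  refine Finset.sum_subset_zero_on_sdiff ?_ ?_ fun _ _ => rfl
  · intro j hj
    simp only [Finset.mem_filter, Finset.mem_univ, true_and] at hj ⊢
    exact hj.2 ▸ (hq j hj.1).2
  · intro j hj
    simp only [Finset.mem_sdiff, Finset.mem_filter, Finset.mem_univ, true_and, not_and] at hj
    suffices i = j by rw [this, sub_self]
    by_contra hij
    have hnp : ¬ Par L i j := by
      rintro (h | h)
      · exact hij h
      · exact (Set.eq_empty_iff_forall_notMem.1 h) _ ⟨hzi, hj.1⟩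
    refine hj.2 hnp ?_
    by_contra hne
    exact hij (hdist ((hline i).eq_of_mem_of_mem (hline j) hne (hq j hnp).1 hzi
      (hq j hnp).2 hj.1))

/-- Theorem 1.6 of the paper. Let `𝒜` consist of `n ≥ 1` pairwise
distinct affine lines in `ℂ²`, `p` a prime with `p ∣ n + 1`. If `𝒜` has at least two
parallel classes and at most one parallel class `C` satisfies `p ∣ #C + 1`, then the
first cohomology of the Aomoto complex over `𝔽_p` vanishes: any `η = Σ cᵢ eᵢ` with
`ν ∧ η ∈ I_{𝔽_p}(𝒜)` is a constant multiple of `ν = Σ eᵢ`. -/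
theorem aomoto_vanishing_mod_p
    {n : ℕ} (hn : 1 ≤ n) (L : Fin n → AffineSubspace ℂ (ℂ × ℂ))
    (hline : ∀ i, IsLine (L i)) (hdist : Function.Injective L)
    (p : ℕ) (hp : p.Prime) (hpn : p ∣ n + 1)
    (hess : ∃ i j : Fin n, ¬ Par L i j)
    (hmu : ∀ i j : Fin n, p ∣ (parClass L i).card + 1 →
      p ∣ (parClass L j).card + 1 → Par L i j)
    (c : Fin n → ZMod p)
    (hker : (∑ i, gen (ZMod p) n i) * (∑ i, c i • gen (ZMod p) n i) ∈
      osIdeal (ZMod p) L) :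
    ∃ t : ZMod p, ∀ i, c i = t := by
  have : Fact p.Prime := ⟨hp⟩
  have hpar := par_iff_direction_eq hline hdist
  have hn0 : (n : ZMod p) = -1 := by
    rw [eq_neg_iff_add_eq_zero]
    exact_mod_cast (ZMod.natCast_eq_zero_iff (n + 1) p).2 hpn
  set S := ∑ i, c i with hS
  have hsum : ∀ i, (((parClass L i).card : ZMod p) + 1) * c i =
      (∑ j ∈ parClass L i, c j) - S := by
    intro i
    have h := sum_not_par_sub_eq_zero hline hdist hker i
    have h1 := Finset.sum_filter_add_sum_filter_not Finset.univ (fun j => Par L i j)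
      (fun j => c i - c j)
    rw [h, add_zero] at h1
    simp only [Finset.sum_sub_distrib, Finset.sum_const, Finset.card_univ, Fintype.card_fin,
      nsmul_eq_mul, hn0, ← hS] at h1
    simp only [parClass]
    linear_combination h1
  have hregular : ∀ i, ¬ p ∣ (parClass L i).card + 1 → c i = -S := by
    intro i hi
    have hi0 : ((parClass L i).card : ZMod p) + 1 ≠ 0 := fun h =>
      hi ((ZMod.natCast_eq_zero_iff _ p).1 (by exact_mod_cast h))
    have hconst : ∀ j ∈ parClass L i, c j = c i := by
      intro j hj
      have hij : parClass L j = parClass L i := by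
        have := (hpar i j).1 (Finset.mem_filter.1 hj).2
        simp only [parClass, hpar, this]
      have h := hsum j
      rw [hij, ← hsum i] at h
      exact mul_left_cancel₀ hi0 h
    have h := hsum i
    rw [Finset.sum_congr rfl hconst, Finset.sum_const, nsmul_eq_mul] at h
    linear_combination h
  refine ⟨-S, fun i => ?_⟩
  by_cases hi : p ∣ (parClass L i).card + 1
  swap
  · exact hregular i hi
  have hother : ∀ k, ¬ Par L i k → c k = -S := fun k hk =>
    hregular k fun hk' => hk (hmu i k hi hk')
  obtain ⟨j, hj⟩ : ∃ j, ¬ Par L i j := by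
    obtain ⟨a, b, hab⟩ := hess
    by_contra! h
    exact hab ((hpar a b).2 (((hpar i a).1 (h a)).symm.trans ((hpar i b).1 (h b))))
  obtain ⟨z, hzi, hzj⟩ := Set.nonempty_iff_ne_empty.2 (not_or.1 hj).2
  have h := sum_sub_eq_zero_of_mem_osIdeal hline hdist hker hzj
  rw [Finset.sum_eq_single i] at h
  · rw [← hother j hj, ← sub_eq_zero, ← neg_sub, h, neg_zero]
  · intro k hk hki
    have hik : ¬ Par L i k := by
      rintro (h | h)
      · exact hki h.symm
      · exact (Set.eq_empty_iff_forall_notMem.1 h) z ⟨hzi, (Finset.mem_filter.1 hk).2⟩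
    rw [hother j hj, hother k hik, sub_self]
  · intro h
    exact absurd (Finset.mem_filter.2 ⟨Finset.mem_univ i, hzi⟩) h
end
end

section
/- Let 𝒜 = {L_1, …, L_n} be n ≥ 1 pairwise distinct affine lines in ℂ², let R be a commutative ring, and let s be the number of parallel classes of 𝒜. Choose a classifying map cl : {1, …, n} → {1, …, s} such that cl(i) = cl(j) if and only if i and j are parallel. Let Φ : Λ(R^n) → Λ(R^s) be the R-algebra homomorphism induced (by functoriality of the exterior algebra) by the R-linear map R^n → R^s sending e_i to ẽ_{cl(i)}. Then Φ maps the Orlik–Solomon ideal I_R(𝒜) into the ideal I_C(s); consequently Φ descends to a surjective R-algebra homomorphism Δ_tot : A_R(𝒜) → A_R(C_s), the total degeneration homomorphism, with Δ_tot(e_i) = ẽ_{cl(i)}. -/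
noncomputable section
open scoped Classical

/-- Generators of the Orlik-Solomon ideal of the central arrangement `C_s` of `s`
lines through the origin in `ℂ²`. -/
def centralGens (R : Type*) [CommRing R] (s : ℕ) :
    Set (ExteriorAlgebra R (Fin s → R)) :=
  {x | ∃ α β γ : Fin s, α ≠ β ∧ α ≠ γ ∧ β ≠ γ ∧
        x = gen R s α * gen R s β - gen R s α * gen R s γ + gen R s β * gen R s γ}

/-- The Orlik-Solomon ideal `I_C(s)` of the central arrangement `C_s`. -/
def centralIdeal (R : Type*) [CommRing R] (s : ℕ) :
    TwoSidedIdeal (ExteriorAlgebra R (Fin s → R)) :=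
  TwoSidedIdeal.span (centralGens R s)

lemma gen_mul_self (R : Type*) [CommRing R] (n : ℕ) (i : Fin n) :
    gen R n i * gen R n i = 0 :=
  ExteriorAlgebra.ι_sq_zero _

lemma map_gen {R : Type*} [CommRing R] {n s : ℕ} {cl : Fin n → Fin s}
    {f : (Fin n → R) →ₗ[R] (Fin s → R)}
    (hf : ∀ i : Fin n, f (Pi.single i 1) = Pi.single (cl i) 1) (i : Fin n) :
    ExteriorAlgebra.map f (gen R n i) = gen R s (cl i) := by
  rw [gen, gen, ExteriorAlgebra.map_apply_ι, hf]

lemma surjective_of_map_single {R : Type*} [CommRing R] {n s : ℕ} {cl : Fin n → Fin s}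
    (hcl : Function.Surjective cl) {f : (Fin n → R) →ₗ[R] (Fin s → R)}
    (hf : ∀ i : Fin n, f (Pi.single i 1) = Pi.single (cl i) 1) :
    Function.Surjective f := by
  rw [← LinearMap.range_eq_top, eq_top_iff, ← (Pi.basisFun R (Fin s)).span_eq,
    Submodule.span_le]
  rintro _ ⟨j, rfl⟩
  obtain ⟨i, rfl⟩ := hcl j
  exact ⟨Pi.single i 1, by rw [hf, Pi.basisFun_apply]⟩

lemma class_ne_of_mem {n s : ℕ} {L : Fin n → AffineSubspace ℂ (ℂ × ℂ)} {cl : Fin n → Fin s}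
    (hcl : ∀ i j, cl i = cl j ↔ Par L i j) {i j : Fin n} (hij : i ≠ j) {p : ℂ × ℂ}
    (hi : p ∈ (L i : Set (ℂ × ℂ))) (hj : p ∈ (L j : Set (ℂ × ℂ))) : cl i ≠ cl j := by
  intro h
  rcases (hcl i j).1 h with h | h
  · exact hij h
  · exact Set.eq_empty_iff_forall_notMem.1 h p ⟨hi, hj⟩

lemma osIdeal_le_comap_centralIdeal {n s : ℕ} {L : Fin n → AffineSubspace ℂ (ℂ × ℂ)}
    {R : Type*} [CommRing R] {cl : Fin n → Fin s} (hcl : ∀ i j, cl i = cl j ↔ Par L i j)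
    {f : (Fin n → R) →ₗ[R] (Fin s → R)}
    (hf : ∀ i : Fin n, f (Pi.single i 1) = Pi.single (cl i) 1) :
    osIdeal R L ≤ (centralIdeal R s).comap (ExteriorAlgebra.map f) := by
  refine TwoSidedIdeal.span_le.2 ?_
  rintro _ (⟨i, j, -, hd, rfl⟩ | ⟨i, j, k, hij, hik, hjk, ⟨p, ⟨hi, hj⟩, hk⟩, rfl⟩)
  · rw [SetLike.mem_coe, TwoSidedIdeal.mem_comap, map_mul, map_gen hf, map_gen hf,
      (hcl i j).2 (Or.inr hd), gen_mul_self]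
    exact zero_mem _
  · rw [SetLike.mem_coe, TwoSidedIdeal.mem_comap]
    simp only [map_add, map_sub, map_mul, map_gen hf]
    exact TwoSidedIdeal.subset_span ⟨cl i, cl j, cl k, class_ne_of_mem hcl hij hi hj,
      class_ne_of_mem hcl hik hi hk, class_ne_of_mem hcl hjk hj hk, rfl⟩

/-- Theorem 3.1 of the paper, total degeneration. Let
`cl : {1,…,n} → {1,…,s}` classify the parallel classes of `𝒜` and let
`Φ = Λ(f) : Λ(R^n) → Λ(R^s)` be induced by the linear map `f` with
`f(e_i) = ẽ_{cl(i)}`. Then `Φ(I_R(𝒜)) ⊆ I_C(s)`, and `Φ` descends to a surjective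
`R`-algebra homomorphism `Δ_tot : A_R(𝒜) → A_R(C_s)` with `Δ_tot(e_i) = ẽ_{cl(i)}`. -/
theorem total_degeneration
    {n : ℕ} (hn : 1 ≤ n) (L : Fin n → AffineSubspace ℂ (ℂ × ℂ))
    (hline : ∀ i, IsLine (L i)) (hdist : Function.Injective L)
    (R : Type*) [CommRing R] {s : ℕ}
    (cl : Fin n → Fin s) (hcl : ∀ i j, cl i = cl j ↔ Par L i j)
    (hclsurj : Function.Surjective cl)
    (f : (Fin n → R) →ₗ[R] (Fin s → R))
    (hf : ∀ i : Fin n, f (Pi.single i 1) = Pi.single (cl i) 1) :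
    (∀ x ∈ osIdeal R L, ExteriorAlgebra.map f x ∈ centralIdeal R s) ∧
    ∃ Δ : (osIdeal R L).ringCon.Quotient →ₐ[R] (centralIdeal R s).ringCon.Quotient,
      Function.Surjective Δ ∧
      (∀ x : ExteriorAlgebra R (Fin n → R),
        Δ ((osIdeal R L).ringCon.mk' x) =
          (centralIdeal R s).ringCon.mk' (ExteriorAlgebra.map f x)) ∧
      (∀ i : Fin n,
        Δ ((osIdeal R L).ringCon.mk' (gen R n i)) =
          (centralIdeal R s).ringCon.mk' (gen R s (cl i))) := by
  have hle := osIdeal_le_comap_centralIdeal (R := R) hcl hf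
  have hmap : ∀ x ∈ osIdeal R L, ExteriorAlgebra.map f x ∈ centralIdeal R s :=
    fun x hx => (TwoSidedIdeal.mem_comap _).1 (hle hx)
  let g := ((centralIdeal R s).ringCon.mkₐ (α := R)).comp (ExteriorAlgebra.map f)
  have hker : (osIdeal R L).ringCon ≤ RingCon.ker g.toRingHom := by
    intro x y hxy
    refine (RingCon.eq _).2 (((centralIdeal R s).rel_iff _ _).2 ?_)
    have h := hmap _ (((osIdeal R L).rel_iff x y).1 hxy)
    rwa [map_sub] at h
  refine ⟨hmap, RingCon.liftₐ _ g hker, ?_, fun x => rfl, fun i => ?_⟩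
  · exact RingCon.lift_surjective_of_surjective hker <| (RingCon.mk'_surjective _).comp <|
      ExteriorAlgebra.map_surjective_iff.2 (surjective_of_map_single hclsurj hf)
  · exact congrArg (centralIdeal R s).ringCon.mk' (map_gen hf i)
end
end

section
/- Let 𝒜 = {L_1, …, L_n} be n ≥ 1 pairwise distinct affine lines in ℂ², let K be a field, and let C ⊊ {1, …, n} be a parallel class of 𝒜 that is not all of {1, …, n}. Let c_1, …, c_n ∈ K be supported on C, i.e. c_i = 0 for all i ∉ C. Set ν = e_1 + ⋯ + e_n and η = c_1 e_1 + ⋯ + c_n e_n in Λ(K^n). If ν ∧ η ∈ I_K(𝒜), then c_i = 0 for all i. (Equivalently: if η ≠ 0 is supported on a proper parallel class, then ν ∧ η ≠ 0 in the Orlik–Solomon algebra A_K(𝒜).) -/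
noncomputable section
open scoped Classical

/-- Two lines of `ℂ²` with different directions meet. -/
theorem IsLine.inter_nonempty {M N : AffineSubspace ℂ (ℂ × ℂ)} (hM : IsLine M) (hN : IsLine N)
    (h : M.direction ≠ N.direction) :
    ((M : Set (ℂ × ℂ)) ∩ (N : Set (ℂ × ℂ))).Nonempty := by
  apply AffineSubspace.inter_nonempty_of_nonempty_of_sup_direction_eq_top hM.1 hN.1
  have hlt : M.direction < M.direction ⊔ N.direction := by
    refine lt_of_le_of_ne le_sup_left fun heq => h ?_
    have hle : N.direction ≤ M.direction := heq ▸ le_sup_right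
    exact (Submodule.eq_of_le_of_finrank_eq hle (hN.2.trans hM.2.symm)).symm
  have h1 := Submodule.finrank_lt_finrank_of_lt hlt
  have h2 := Submodule.finrank_le (M.direction ⊔ N.direction)
  apply Submodule.eq_top_of_finrank_eq
  have h3 : Module.finrank ℂ (ℂ × ℂ) = 2 := by simp
  have h4 := hM.2
  omega

/-- Two lines of `ℂ²` sharing two distinct points are equal. -/
theorem IsLine.eq_of_mem {M N : AffineSubspace ℂ (ℂ × ℂ)} (hM : IsLine M) (hN : IsLine N)
    {p q : ℂ × ℂ} (hpq : p ≠ q) (hpM : p ∈ M) (hqM : q ∈ M) (hpN : p ∈ N) (hqN : q ∈ N) :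
    M = N := by
  have key : ∀ {P : AffineSubspace ℂ (ℂ × ℂ)}, IsLine P → p ∈ P → q ∈ P →
      Submodule.span ℂ {p -ᵥ q} = P.direction := by
    intro P hP hp hq
    apply Submodule.eq_of_le_of_finrank_eq
    · rw [Submodule.span_singleton_le_iff_mem]
      exact AffineSubspace.vsub_mem_direction hp hq
    · rw [finrank_span_singleton (vsub_ne_zero.mpr hpq), hP.2]
  exact AffineSubspace.ext_of_direction_eq
    ((key hM hpM hqM).symm.trans (key hN hpN hqN)) ⟨p, hpM, hpN⟩

section Representation

variable (K : Type*) [Field K]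

/-- Left multiplication by the first generator on the exterior algebra of `K²`. -/
def extMulLeftFst : Matrix (Fin 4) (Fin 4) K :=
  !![0, 0, 0, 0; 1, 0, 0, 0; 0, 0, 0, 0; 0, 0, 1, 0]

/-- Left multiplication by the second generator on the exterior algebra of `K²`. -/
def extMulLeftSnd : Matrix (Fin 4) (Fin 4) K :=
  !![0, 0, 0, 0; 0, 0, 0, 0; 1, 0, 0, 0; 0, -1, 0, 0]

/-- The product of `extMulLeftFst` and `extMulLeftSnd`. -/
def extMulLeftTop : Matrix (Fin 4) (Fin 4) K :=
  !![0, 0, 0, 0; 0, 0, 0, 0; 0, 0, 0, 0; 1, 0, 0, 0]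

theorem extMulLeft_mul (a b a' b' : K) :
    (a • extMulLeftFst K + b • extMulLeftSnd K) * (a' • extMulLeftFst K + b' • extMulLeftSnd K) =
      (a * b' - b * a') • extMulLeftTop K := by
  ext i j
  fin_cases i <;> fin_cases j <;>
    simp [extMulLeftFst, extMulLeftSnd, extMulLeftTop, Matrix.mul_apply, Fin.sum_univ_four]
  ring

theorem extMulLeftTop_ne_zero : extMulLeftTop K ≠ 0 := by
  intro h
  have := congrFun (congrFun h 3) 0
  simp [extMulLeftTop] at this

variable {K} {n : ℕ}

/-- The representation of `Λ(Kⁿ)` obtained from a pair of linear forms `Kⁿ → K`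
and left multiplication on the exterior algebra of `K²`. -/
def extRep (s t : (Fin n → K) →ₗ[K] K) :
    ExteriorAlgebra K (Fin n → K) →ₐ[K] Matrix (Fin 4) (Fin 4) K :=
  ExteriorAlgebra.lift K
    ⟨s.smulRight (extMulLeftFst K) + t.smulRight (extMulLeftSnd K), fun m => by
      simp only [LinearMap.add_apply, LinearMap.smulRight_apply, extMulLeft_mul]
      rw [mul_comm, sub_self, zero_smul]⟩

theorem extRep_ι_mul_ι (s t : (Fin n → K) →ₗ[K] K) (x y : Fin n → K) :
    extRep s t (ExteriorAlgebra.ι K x * ExteriorAlgebra.ι K y) =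
      (s x * t y - t x * s y) • extMulLeftTop K := by
  simp [extRep, ExteriorAlgebra.lift_ι_apply, extMulLeft_mul]

end Representation

theorem sum_smul_gen {K : Type*} [Field K] {n : ℕ} (c : Fin n → K) :
    ∑ i, c i • gen K n i = ExteriorAlgebra.ι K c := by
  simp only [gen, ← map_smul, ← map_sum]
  congr 1
  ext k
  simp [Finset.sum_apply, Pi.single_apply]

/-- The Orlik-Solomon ideal lies in the kernel of the representation attached to a line
`L j` and a point `p` on it, with linear forms the sum of the coordinates of the lines
through `p` and the `j`-th coordinate. -/
theorem extRep_eq_zero_of_mem_osIdeal {K : Type*} [Field K] {n : ℕ}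
    {L : Fin n → AffineSubspace ℂ (ℂ × ℂ)}
    (hline : ∀ i, IsLine (L i)) (hdist : Function.Injective L) {j : Fin n} {p : ℂ × ℂ}
    (hj : p ∈ L j) {x : ExteriorAlgebra K (Fin n → K)} (hx : x ∈ osIdeal K L) :
    extRep (∑ k with p ∈ L k, LinearMap.proj k) (LinearMap.proj j) x = 0 := by
  set φ := extRep (K := K) (∑ k with p ∈ L k, LinearMap.proj k) (LinearMap.proj j) with hφ
  have hgen : ∀ a b : Fin n, φ (gen K n a * gen K n b) =
      ((if p ∈ L a then 1 else 0) * (if b = j then 1 else 0) -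
        (if a = j then 1 else 0) * (if p ∈ L b then 1 else 0) : K) • extMulLeftTop K := by
    intro a b
    rw [hφ, gen, gen, extRep_ι_mul_ι]
    simp [LinearMap.sum_apply, Pi.single_apply, eq_comm]
  suffices h : osIdeal K L ≤ TwoSidedIdeal.ker φ from (TwoSidedIdeal.mem_ker _).mp (h hx)
  refine TwoSidedIdeal.span_le.mpr ?_
  rintro y (⟨a, b, -, hab, rfl⟩ | ⟨a, b, d, hab, had, hbd, ⟨q, ⟨hqa, hqb⟩, hqd⟩, rfl⟩) <;>
    rw [SetLike.mem_coe, TwoSidedIdeal.mem_ker]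
  · have hnot : p ∈ L a → p ∉ L b := fun ha hb => by
      have : p ∈ (L a : Set (ℂ × ℂ)) ∩ (L b : Set (ℂ × ℂ)) := ⟨ha, hb⟩
      simp [hab] at this
    rw [hgen]
    apply smul_eq_zero_of_left
    grind
  · rw [map_add, map_sub, hgen, hgen, hgen, ← sub_smul, ← add_smul]
    by_cases hpq : p = q
    · subst hpq
      have ha : p ∈ L a := hqa
      have hb : p ∈ L b := hqb
      have hd : p ∈ L d := hqd
      simp [ha, hb, hd]
    · have key : ∀ {k l : Fin n}, k ≠ l → q ∈ L k → q ∈ L l → p ∈ L k → p ∉ L l :=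
        fun hkl hk hl hpk hpl =>
          hkl (hdist ((hline _).eq_of_mem (hline _) hpq hpk hk hpl hl))
      have h1 := key hab hqa hqb
      have h2 := key had hqa hqd
      have h3 := key hbd hqb hqd
      clear hgen
      apply smul_eq_zero_of_left
      grind

/-- If the coefficients `cᵢ` are supported on a proper parallel class
`C` of `𝒜` (here `C` is the class of the index `i₀`, and there is an index not parallel
to `i₀`) and `ν ∧ η ∈ I_K(𝒜)` for `ν = Σ eᵢ`, `η = Σ cᵢeᵢ`, then `η = 0`. -/
theorem supported_on_proper_class_vanishing
    {n : ℕ} (hn : 1 ≤ n) (L : Fin n → AffineSubspace ℂ (ℂ × ℂ))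
    (hline : ∀ i, IsLine (L i)) (hdist : Function.Injective L)
    (K : Type*) [Field K] (c : Fin n → K)
    (i₀ : Fin n) (hproper : ∃ j : Fin n, ¬ Par L i₀ j)
    (hsupp : ∀ j : Fin n, ¬ Par L i₀ j → c j = 0)
    (hker : (∑ i, gen K n i) * (∑ i, c i • gen K n i) ∈ osIdeal K L) :
    ∀ i : Fin n, c i = 0 := by
  obtain ⟨j, hj⟩ := hproper
  intro i
  by_cases hi : Par L i₀ i
  swap
  · exact hsupp i hi
  have hcj := hsupp j hj
  simp only [par_iff_direction_eq hline hdist] at hi hj hsupp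
  obtain ⟨p, hpi, hpj⟩ := (hline i).inter_nonempty (hline j) (fun h => hj (hi.trans h))
  have hrep := extRep_eq_zero_of_mem_osIdeal hline hdist hpj hker
  have hν : ∑ k, gen K n k = ExteriorAlgebra.ι K (fun _ => (1 : K)) := by
    simp [← sum_smul_gen]
  have hsum : ∑ k with p ∈ L k, c k = c i := by
    refine Finset.sum_eq_single_of_mem i (by simpa using hpi) fun k hk hki => hsupp k fun h => ?_
    exact hki (hdist (AffineSubspace.ext_of_direction_eq (h.symm.trans hi)
      ⟨p, by simpa using hk, hpi⟩))
  rw [hν, sum_smul_gen, extRep_ι_mul_ι] at hrep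
  simpa [LinearMap.sum_apply, hsum, hcj, extMulLeftTop_ne_zero] using hrep
end
end
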